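/- arXiv:2603.24880 — 2 statements merged into one kernel-verified Lean document; each statement's English description precedes it below -/
import Mathlib

section
/- Let (Z, δ) be a configuration such that (i) Z has diameter at most 4, and (ii) whenever u and w are vertices at Z-distance exactly 4, there is a path P of length 4 joining them in Z such that either P is not contained in the outer face boundary of Z, or P = (u, v₁, v₂, v₃, w) is contained in the outer face boundary and some vᵢ is not a cut-vertex of Z and has external degree δ(vᵢ) − d_Z(vᵢ) ≥ 2. If a planar triangulation G contains (Z, δ) and G has no obstructing cycle all of whose vertices lie in the copy of Z, then (Z, δ) is induced in G. -/
/-!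
Common formal framework for statements from
"A near-linear time 4-coloring algorithm for planar graphs".

Plane embeddings are modelled combinatorially by rotation systems on darts
(Heffter–Edmonds): a graph together with a rotation system embeds in the
orientable surface whose faces are the orbits of the face-tracing permutation,
and the embedding is in the 2-sphere precisely when Euler's relation holds.
-/

namespace FourColor

open SimpleGraph

/-- Degree of a vertex, as the cardinality of its neighbour set. -/
noncomputable def vdeg {V : Type} (G : SimpleGraph V) (v : V) : ℕ :=
  (G.neighborSet v).ncard

/-- Dart reversal, as a permutation of the darts of a graph. -/
def dartRev {V : Type} (G : SimpleGraph V) : Equiv.Perm G.Dart where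
  toFun := SimpleGraph.Dart.symm
  invFun := SimpleGraph.Dart.symm
  left_inv d := SimpleGraph.Dart.symm_symm d
  right_inv d := SimpleGraph.Dart.symm_symm d

/-- A combinatorial embedding (rotation system) of a graph: a permutation of the
darts fixing tails, whose restriction to the darts out of each vertex is a
single cycle (the clockwise rotation around the vertex). -/
structure CombEmbedding {V : Type} (G : SimpleGraph V) where
  rot : Equiv.Perm G.Dart
  rot_fst : ∀ d : G.Dart, (rot d).toProd.1 = d.toProd.1
  rot_cyclic : ∀ d d' : G.Dart, d.toProd.1 = d'.toProd.1 → ∃ n : ℕ, (rot ^ n) d = d'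

namespace CombEmbedding

variable {V : Type} {G : SimpleGraph V}

/-- The face-tracing permutation of an embedding. -/
def facePerm (E : CombEmbedding G) : Equiv.Perm G.Dart :=
  (dartRev G).trans E.rot

/-- Two darts lie on the same face iff they are in the same orbit of the
face-tracing permutation. -/
def faceSetoid (E : CombEmbedding G) : Setoid G.Dart where
  r d d' := ∃ n : ℤ, (E.facePerm ^ n) d = d'
  iseqv := by
    refine ⟨fun d => ⟨0, by simp⟩, ?_, ?_⟩
    · rintro d d' ⟨n, h⟩
      refine ⟨-n, ?_⟩
      rw [← h, ← Equiv.Perm.mul_apply, ← zpow_add, neg_add_cancel, zpow_zero,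
        Equiv.Perm.one_apply]
    · rintro a b c ⟨m, h1⟩ ⟨n, h2⟩
      refine ⟨n + m, ?_⟩
      rw [← h2, ← h1, ← Equiv.Perm.mul_apply, ← zpow_add]

/-- The number of faces of an embedding. -/
noncomputable def numFaces (E : CombEmbedding G) : ℕ :=
  Nat.card (Quotient E.faceSetoid)

/-- Euler's relation characterising embeddings of a (possibly disconnected)
finite graph in the 2-sphere: `V - E + F = 2·(#components) - (#isolated vertices)`. -/
def IsSpherical [Fintype V] (E : CombEmbedding G) : Prop :=
  (Fintype.card V : ℤ) - (G.edgeSet.ncard : ℤ) + (E.numFaces : ℤ) =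
    2 * (Nat.card G.ConnectedComponent : ℤ) - (({v : V | ∀ w, ¬ G.Adj v w}).ncard : ℤ)

end CombEmbedding

/-- A finite simple graph is planar iff it admits a rotation system
satisfying Euler's relation for the sphere. -/
def IsPlanar {V : Type} [Fintype V] (G : SimpleGraph V) : Prop :=
  ∃ E : CombEmbedding G, E.IsSpherical

/-- A planar triangulation: a connected simple graph embedded in the 2-sphere
(Euler's relation) all of whose faces are triangles. -/
structure PlaneTriangulation (V : Type) [Fintype V] where
  graph : SimpleGraph V
  emb : CombEmbedding graph
  conn : graph.Connected
  euler : (Fintype.card V : ℤ) - (graph.edgeSet.ncard : ℤ) + (emb.numFaces : ℤ) = 2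
  faces_tri : ∀ d : graph.Dart, (emb.facePerm ^ 3) d = d ∧ emb.facePerm d ≠ d

/-- A near-triangulation: a connected plane graph, with a designated outer face,
all of whose faces except the outer one are triangles.  (The trivial
near-triangulations on a single vertex are allowed.) -/
structure NearTriangulation (V : Type) [Fintype V] where
  graph : SimpleGraph V
  emb : CombEmbedding graph
  conn : graph.Connected
  euler : Fintype.card V = 1 ∨
    (Fintype.card V : ℤ) - (graph.edgeSet.ncard : ℤ) + (emb.numFaces : ℤ) = 2
  /-- membership of a dart in the (boundary walk of the) outer face -/
  isOuter : graph.Dart → Prop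
  outer_closed : ∀ d, isOuter d → isOuter (emb.facePerm d)
  outer_single : ∀ d d', isOuter d → isOuter d' → ∃ n : ℕ, (emb.facePerm ^ n) d = d'
  outer_nonempty : ∀ _ : graph.Dart, ∃ d', isOuter d'
  inner_tri : ∀ d, ¬ isOuter d → (emb.facePerm ^ 3) d = d ∧ emb.facePerm d ≠ d

namespace NearTriangulation

variable {V : Type} [Fintype V]

/-- A vertex lies on the outer face boundary. -/
def OnOuter (N : NearTriangulation V) (v : V) : Prop :=
  IsEmpty N.graph.Dart ∨ ∃ d : N.graph.Dart, N.isOuter d ∧ d.toProd.1 = v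

/-- An edge lies on the outer face boundary. -/
def IsOuterEdge (N : NearTriangulation V) (x y : V) : Prop :=
  ∃ d : N.graph.Dart, N.isOuter d ∧ (d.toProd = (x, y) ∨ d.toProd = (y, x))

end NearTriangulation

/-- `v` is a cut-vertex of `G`: deleting it increases the number of
connected components. -/
def IsCutVertex {V : Type} (G : SimpleGraph V) (v : V) : Prop :=
  Nat.card G.ConnectedComponent <
    Nat.card (G.induce {w : V | w ≠ v}).ConnectedComponent

/-- A configuration `(Z, δ)`: a near-triangulation together with a degree
function which agrees with the degree at interior vertices, exceeds it at
outer vertices, and with at most one cut-vertex, lying in exactly two blocks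
and having external degree 2. -/
structure Configuration (V : Type) [Fintype V] extends NearTriangulation V where
  δ : V → ℕ
  delta_inner : ∀ v : V, ¬ toNearTriangulation.OnOuter v → δ v = vdeg graph v
  delta_outer : ∀ v : V, toNearTriangulation.OnOuter v → vdeg graph v < δ v
  cut_unique : ∀ u w : V, IsCutVertex graph u → IsCutVertex graph w → u = w
  cut_cond : ∀ v : V, IsCutVertex graph v →
    Nat.card (graph.induce {w : V | w ≠ v}).ConnectedComponent = 2 ∧
    δ v = vdeg graph v + 2

/-- The map induced on darts by an adjacency-preserving vertex map. -/
def dartMap {A V : Type} {ZG : SimpleGraph A} {G : SimpleGraph V} (f : A → V)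
    (h : ∀ ⦃a b : A⦄, ZG.Adj a b → G.Adj (f a) (f b)) (d : ZG.Dart) : G.Dart :=
  ⟨(f d.toProd.1, f d.toProd.2), h d.adj⟩

/-- An orientation-preserving homomorphism of a configuration into a plane
triangulation: adjacency-preserving, sending inner facial triangles to facial
triangles with the same orientation, and matching the prescribed degrees. -/
def IsConfigHomMap {A V : Type} [Fintype A] [Fintype V] (C : Configuration A)
    (T : PlaneTriangulation V) (f : A → V) : Prop :=
  ∃ h : ∀ ⦃a b : A⦄, C.graph.Adj a b → T.graph.Adj (f a) (f b),
    (∀ v : A, vdeg T.graph (f v) = C.δ v) ∧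
    (∀ d : C.graph.Dart, ¬ C.isOuter d →
      T.emb.facePerm (dartMap f h d) = dartMap f h (C.emb.facePerm d))

/-- `f` exhibits the configuration `C` as being contained in the plane
triangulation `T`: an injective orientation-preserving homomorphism matching
degrees; moreover at a cut-vertex the two incident edges of `T` not coming
from `C` are non-consecutive in the rotation. -/
def IsContainMap {A V : Type} [Fintype A] [Fintype V] (C : Configuration A)
    (T : PlaneTriangulation V) (f : A → V) : Prop :=
  Function.Injective f ∧ IsConfigHomMap C T f ∧
  ∀ v : A, IsCutVertex C.graph v →
    ∀ e e' : T.graph.Dart, e.toProd.1 = f v → e'.toProd.1 = f v →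
      (¬ ∃ a b : A, C.graph.Adj a b ∧ e.toProd = (f a, f b)) →
      (¬ ∃ a b : A, C.graph.Adj a b ∧ e'.toProd = (f a, f b)) →
      e ≠ e' → T.emb.rot e ≠ e'

/-- A configuration on a concrete finite vertex set. -/
def ConfigOn : Type := Σ n : ℕ, Configuration (Fin n)

/-- The configuration `C` is contained in `T` within the set `S` of vertices. -/
def ConfigOn.ContainedIn (C : ConfigOn) {V : Type} [Fintype V]
    (T : PlaneTriangulation V) (S : Set V) : Prop :=
  ∃ f : Fin C.1 → V, IsContainMap C.2 T f ∧ Set.range f ⊆ S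

/-- The configuration `C` is induced in `T` within the set `S` of vertices. -/
def ConfigOn.InducedIn (C : ConfigOn) {V : Type} [Fintype V]
    (T : PlaneTriangulation V) (S : Set V) : Prop :=
  ∃ f : Fin C.1 → V, IsContainMap C.2 T f ∧ Set.range f ⊆ S ∧
    ∀ a b : Fin C.1, T.graph.Adj (f a) (f b) → C.2.graph.Adj a b

/-- Paper condition (ii) of Lemma `induced-config`: any two vertices at
distance exactly 4 are joined by a length-4 path which either is not contained
in the outer face boundary, or contains an internal vertex which is not a
cut-vertex and has external degree at least 2. -/
def SecondNbrCond {A : Type} [Fintype A] (C : Configuration A) : Prop :=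
  ∀ u w : A, C.graph.dist u w = 4 →
    ∃ p : C.graph.Walk u w, p.IsPath ∧ p.length = 4 ∧
      ((¬ ∀ d ∈ p.darts, C.toNearTriangulation.IsOuterEdge d.toProd.1 d.toProd.2) ∨
        ∃ x ∈ p.support, x ≠ u ∧ x ≠ w ∧ ¬ IsCutVertex C.graph x ∧
          vdeg C.graph x + 2 ≤ C.δ x)

/-! ### Balls and obstructing cycles -/

/-- The set of vertices at distance at most `k` from `v` (vertex set of `B_k(v)`). -/
def ballSet {V : Type} (G : SimpleGraph V) (v : V) (k : ℕ) : Set V :=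
  {u | ∃ p : G.Walk v u, p.length ≤ k}

/-- Vertex set of the degree-bounded ball `B^8_k(v)`. -/
def dBallSet {V : Type} (G : SimpleGraph V) (v : V) (k : ℕ) : Set V :=
  {u | ∃ p : G.Walk v u, p.length ≤ k ∧ ∀ x ∈ p.support, x = v ∨ vdeg G x ≤ 8}

/-- Vertex set of the extended degree-bounded ball `B̄^8_k(v)`. -/
def extdBallSet {V : Type} (G : SimpleGraph V) (v : V) (k : ℕ) : Set V :=
  dBallSet G v k ∪
    {u | 9 ≤ vdeg G u ∧ ∃ p : G.Walk v u, p.length ≤ k ∧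
      ∀ x ∈ p.support, x = v ∨ x = u ∨ vdeg G x ≤ 8}

/-- An obstructing cycle: a cycle of length at most 4 with at least one vertex
on each of its two sides, or of length 5 with at least two vertices on each
side.  (The two sides of a cycle of a plane triangulation are unions of
components of the complement, with no edges from one side to the other.) -/
def IsObstructingCycle {V : Type} {G : SimpleGraph V} {x : V} (c : G.Walk x x) : Prop :=
  c.IsCycle ∧
  ∃ A B : Set V,
    (∀ v : V, v ∉ c.support → v ∈ A ∨ v ∈ B) ∧
    (∀ v ∈ A, v ∉ c.support) ∧ (∀ v ∈ B, v ∉ c.support) ∧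
    Disjoint A B ∧
    (∀ a ∈ A, ∀ b ∈ B, ¬ G.Adj a b) ∧
    ((c.length ≤ 4 ∧ A.Nonempty ∧ B.Nonempty) ∨
      (c.length = 5 ∧ 2 ≤ A.ncard ∧ 2 ≤ B.ncard))

/-- `G` has an obstructing cycle all of whose vertices lie in `S`. -/
def HasObstructingCycleIn {V : Type} (G : SimpleGraph V) (S : Set V) : Prop :=
  ∃ (x : V) (c : G.Walk x x), IsObstructingCycle c ∧ ∀ y ∈ c.support, y ∈ S

/-- A chordless cycle: every edge of `G` between vertices of the cycle is an
edge of the cycle. -/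
def IsChordless {V : Type} {G : SimpleGraph V} {x : V} (c : G.Walk x x) : Prop :=
  ∀ u v : V, u ∈ c.support → v ∈ c.support → G.Adj u v → s(u, v) ∈ c.edges

/-- Two vertex sets touch: they share a vertex, or an edge of `G` joins them. -/
def Touches {V : Type} (G : SimpleGraph V) (S S' : Set V) : Prop :=
  (S ∩ S').Nonempty ∨ ∃ s ∈ S, ∃ t ∈ S', G.Adj s t

/-- A `k`-local obstructing cycle around `v`, with designated public part
`pub`: the cycle lies in `B̄^8_k(v)`, the public part consists of at most two
vertices which are consecutive on the cycle, and everything outside the public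
part (the private part) lies in `B^8_k(v)`. -/
def IsLocalObstructing {V : Type} (G : SimpleGraph V) (v : V) (k : ℕ) {x : V}
    (c : G.Walk x x) (pub : Set V) : Prop :=
  IsObstructingCycle c ∧
  (∀ y ∈ c.support, y ∈ extdBallSet G v k) ∧
  pub ⊆ {y | y ∈ c.support} ∧
  pub.ncard ≤ 2 ∧
  (∀ y ∈ pub, ∀ z ∈ pub, y ≠ z → s(y, z) ∈ c.edges) ∧
  (∀ y ∈ c.support, y ∉ pub → y ∈ dBallSet G v k)

/-! ### Discharging and charges -/

/-- Initial charge `T₀(v) = 10·(6 − d(v))`. -/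
noncomputable def initialCharge {V : Type} (G : SimpleGraph V) (v : V) : ℤ :=
  10 * (6 - (vdeg G v : ℤ))

/-- Final charge of `v`, given the function `send u v` recording the total
charge sent from `u` to `v` by the discharging rules (`send u v = 0` for
non-adjacent `u, v`). -/
noncomputable def finalCharge {V : Type} [Fintype V] (G : SimpleGraph V)
    (send : V → V → ℤ) (v : V) : ℤ :=
  initialCharge G v + ∑ u : V, (send u v - send v u)

/-- A discharging assignment: for every plane triangulation, an amount of
charge sent along each ordered pair of vertices, nonnegative and vanishing on
non-adjacent pairs.  (The paper's fixed set `ℛ` of 43 discharging rules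
determines such an assignment.) -/
def IsDischargeAssignment
    (Φ : ∀ (V : Type) [Fintype V], PlaneTriangulation V → V → V → ℤ) : Prop :=
  ∀ (V : Type) [Fintype V] (T : PlaneTriangulation V) (u v : V),
    (¬ T.graph.Adj u v → Φ V T u v = 0) ∧ 0 ≤ Φ V T u v

/-! ### Colorings and Kempe changes -/

/-- A proper 4-coloring. -/
def IsProperColoring {U : Type} (G : SimpleGraph U) (c : U → Fin 4) : Prop :=
  ∀ ⦃u v : U⦄, G.Adj u v → c u ≠ c v

/-- `u` and `w` lie in a common `ab`-Kempe chain inside `S`. -/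
def KempeConnOn {U : Type} (G : SimpleGraph U) (S : Set U) (c : U → Fin 4)
    (a b : Fin 4) (u w : U) : Prop :=
  ∃ p : G.Walk u w, ∀ x ∈ p.support, x ∈ S ∧ (c x = a ∨ c x = b)

/-- A Kempe change (within the vertex set `S`): for complementary color pairs
`{a,b}` and `{e,f}`, swap the two colors on some `ab`-Kempe chains and some
`ef`-Kempe chains. -/
def IsKempeChangeOn {U : Type} (G : SimpleGraph U) (S : Set U)
    (c c' : U → Fin 4) : Prop :=
  (∀ v ∉ S, c' v = c v) ∧
  ∃ a b e f : Fin 4, ({a, b, e, f} : Set (Fin 4)) = Set.univ ∧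
    (∀ v ∈ S, c' v = c v ∨ (c v = a ∧ c' v = b) ∨ (c v = b ∧ c' v = a) ∨
      (c v = e ∧ c' v = f) ∨ (c v = f ∧ c' v = e)) ∧
    (∀ u w : U, (KempeConnOn G S c a b u w ∨ KempeConnOn G S c e f u w) →
      ((c' u = c u) ↔ (c' w = c w)))

/-- A Kempe change. -/
def IsKempeChange {U : Type} (G : SimpleGraph U) (c c' : U → Fin 4) : Prop :=
  IsKempeChangeOn G Set.univ c c'

/-- A single Kempe change: swap two colors on one Kempe chain. -/
def IsSingleKempeChange {U : Type} (G : SimpleGraph U) (c c' : U → Fin 4) : Prop :=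
  ∃ a b : Fin 4, a ≠ b ∧ ∃ u₀ : U, (c u₀ = a ∨ c u₀ = b) ∧
    ∀ v : U,
      (KempeConnOn G Set.univ c a b u₀ v →
        ((c v = a ∧ c' v = b) ∨ (c v = b ∧ c' v = a))) ∧
      (¬ KempeConnOn G Set.univ c a b u₀ v → c' v = c v)

/-- Two colorings agree up to a permutation of the colors. -/
def ColorPermEq {α : Type} (κ κ' : α → Fin 4) : Prop :=
  ∃ σ : Equiv.Perm (Fin 4), ∀ x : α, κ' x = σ (κ x)

/-! ### Free completions, rings, reducibility -/

/-- A free completion of the configuration `C`, with ring vertex set `W`: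
a near-triangulation on `A ⊕ W` whose outer face is the ring cycle on `W`
(disjoint from `C`), containing `C` with the prescribed degrees and inner
faces. -/
structure FreeCompletion {A : Type} [Fintype A] (C : Configuration A)
    (W : Type) [Fintype W] where
  nt : NearTriangulation (A ⊕ W)
  ring_outer : ∀ x : A ⊕ W, nt.OnOuter x ↔ ∃ w : W, x = Sum.inr w
  outer_simple : ∀ d d' : nt.graph.Dart, nt.isOuter d → nt.isOuter d' →
    d.toProd.1 = d'.toProd.1 → d = d'
  adj_iff : ∀ a b : A, nt.graph.Adj (Sum.inl a) (Sum.inl b) ↔ C.graph.Adj a b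
  deg_eq : ∀ a : A, vdeg nt.graph (Sum.inl a) = C.δ a
  faces_comm : ∀ d : C.graph.Dart, ¬ C.isOuter d →
    nt.emb.facePerm (dartMap Sum.inl (fun a b hab => (adj_iff a b).mpr hab) d) =
      dartMap Sum.inl (fun a b hab => (adj_iff a b).mpr hab) (C.emb.facePerm d)
  ring_edges_outer : ∀ w w' : W, nt.graph.Adj (Sum.inr w) (Sum.inr w') →
    ∃ d : nt.graph.Dart, nt.isOuter d ∧
      ((d.toProd.1 = Sum.inr w ∧ d.toProd.2 = Sum.inr w') ∨
       (d.toProd.1 = Sum.inr w' ∧ d.toProd.2 = Sum.inr w))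

namespace FreeCompletion

variable {A W : Type} [Fintype A] [Fintype W] {C : Configuration A}

/-- Adjacency on the ring. -/
def RingAdj (FC : FreeCompletion C W) (w w' : W) : Prop :=
  FC.nt.graph.Adj (Sum.inr w) (Sum.inr w')

/-- A proper 4-coloring of the ring. -/
def RingProper (FC : FreeCompletion C W) (κ : W → Fin 4) : Prop :=
  ∀ w w' : W, FC.RingAdj w w' → κ w ≠ κ w'

end FreeCompletion

/-- `j` embeds a cycle into `G'` so that its image bounds a face of the
embedding `E'`. -/
def IsFacialEmbedding {W U : Type} {G' : SimpleGraph U} (E' : CombEmbedding G')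
    (j : W → U) : Prop :=
  ∃ F : Set G'.Dart, F.Nonempty ∧ (∀ d ∈ F, E'.facePerm d ∈ F) ∧
    (∀ d ∈ F, ∀ d' ∈ F, ∃ n : ℕ, (E'.facePerm ^ n) d = d') ∧
    (∀ w : W, ∃ d ∈ F, d.toProd.1 = j w) ∧
    (∀ d ∈ F, (∃ w : W, d.toProd.1 = j w) ∧ (∃ w : W, d.toProd.2 = j w))

/-- `i`-extendibility of a ring coloring `κ` (Birkhoff–Kempe reducibility):
`κ` is `0`-extendible if it extends to a proper 4-coloring of the free
completion; it is `(i+1)`-extendible if it is `i`-extendible or if, for every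
plane graph `G'` containing the ring as a facial cycle and every proper
4-coloring of `G'` extending `κ`, some Kempe change yields a coloring whose
restriction to the ring is `i`-extendible. -/
def FreeCompletion.Extendible {A W : Type} [Fintype A] [Fintype W]
    {C : Configuration A} (FC : FreeCompletion C W) :
    ℕ → (W → Fin 4) → Prop
  | 0, κ => ∃ c : A ⊕ W → Fin 4, IsProperColoring FC.nt.graph c ∧
      ∀ w : W, c (Sum.inr w) = κ w
  | (i + 1), κ => FreeCompletion.Extendible FC i κ ∨
      ∀ (U : Type) [Fintype U] (G' : SimpleGraph U) (E' : CombEmbedding G'),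
        E'.IsSpherical →
        ∀ j : W → U, Function.Injective j →
          (∀ w w' : W, FC.RingAdj w w' ↔ G'.Adj (j w) (j w')) →
          IsFacialEmbedding E' j →
          ∀ c : U → Fin 4, IsProperColoring G' c → (∀ w : W, c (j w) = κ w) →
            ∃ c' : U → Fin 4, IsProperColoring G' c' ∧ IsKempeChange G' c c' ∧
              FreeCompletion.Extendible FC i (fun w => c' (j w))

/-- The reducibility level of a ring coloring: the least `i` such that it is
`i`-extendible. -/
noncomputable def FreeCompletion.level {A W : Type} [Fintype A] [Fintype W]
    {C : Configuration A} (FC : FreeCompletion C W) (κ : W → Fin 4) : ℕ :=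
  sInf {i : ℕ | FC.Extendible i κ}

/-- A configuration is D-reducible if, for some finite `i`, every proper
4-coloring of the ring of any free completion is `i`-extendible. -/
def DReducible {A : Type} [Fintype A] (C : Configuration A) : Prop :=
  ∃ i : ℕ, ∀ (W : Type) [Fintype W] (FC : FreeCompletion C W) (κ : W → Fin 4),
    FC.RingProper κ → FC.Extendible i κ

/-- The defining properties of the paper's fixed set `𝒟` of 8202 D-reducible
configurations: each has at most 19 vertices, diameter at most 4, at most one
vertex of (prescribed) degree exceeding 8, ring size at most 18, and every
4-coloring of its ring is 25-extendible. -/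
def DSetGood (𝓓 : Set ConfigOn) : Prop :=
  𝓓.ncard = 8202 ∧
  ∀ C ∈ 𝓓,
    C.1 ≤ 19 ∧
    (∀ a b : Fin C.1, C.2.graph.dist a b ≤ 4) ∧
    ({v : Fin C.1 | 8 < C.2.δ v}).ncard ≤ 1 ∧
    ∃ (r : ℕ) (FC : FreeCompletion C.2 (Fin r)), r ≤ 18 ∧
      ∀ κ : Fin r → Fin 4, FC.RingProper κ → FC.Extendible 25 κ

end FourColor
namespace FourColor

open SimpleGraph

section FaceFunctions

variable {V : Type} {G : SimpleGraph V}

lemma CombEmbedding.rot_eq_facePerm_symm (E : CombEmbedding G) (d : G.Dart) :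
    E.rot d = E.facePerm d.symm := by
  simp [CombEmbedding.facePerm, dartRev]

/-- A property of darts at a vertex that is preserved by the rotation and holds at one dart
holds at all darts with the same tail. -/
lemma CombEmbedding.rot_induction (E : CombEmbedding G) {P : G.Dart → Prop} {d d' : G.Dart}
    (hdd' : d.fst = d'.fst) (hd : P d)
    (hP : ∀ e : G.Dart, e.fst = d.fst → P e → P (E.rot e)) : P d' := by
  obtain ⟨n, rfl⟩ := E.rot_cyclic d d' hdd'
  have key : ∀ m : ℕ, ((E.rot ^ m) d).fst = d.fst ∧ P ((E.rot ^ m) d) := by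
    intro m
    induction m with
    | zero => exact ⟨rfl, hd⟩
    | succ m ih =>
      rw [pow_succ', Equiv.Perm.mul_apply]
      exact ⟨(E.rot_fst _).trans ih.1, hP _ ih.1 ih.2⟩
  exact (key n).2

lemma CombEmbedding.quotient_facePerm (E : CombEmbedding G) (d : G.Dart) :
    (Quotient.mk E.faceSetoid (E.facePerm d)) = Quotient.mk E.faceSetoid d :=
  Quotient.sound (E.faceSetoid.symm ⟨1, by simp⟩)

/-- A function on the faces taking equal values on both sides of every edge is constant. -/
lemma CombEmbedding.faceFunction_const (E : CombEmbedding G) (hconn : G.Connected)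
    {g : G.Dart → ZMod 2} (hface : ∀ d, g (E.facePerm d) = g d)
    (hedge : ∀ d : G.Dart, g d = g d.symm) (d d' : G.Dart) : g d = g d' := by
  have hrot : ∀ e e' : G.Dart, e.fst = e'.fst → g e = g e' := by
    intro e e' h
    refine E.rot_induction (P := fun x => g e = g x) h rfl ?_
    intro x _ hx
    rw [E.rot_eq_facePerm_symm, hface, ← hedge, hx]
  have hwalk : ∀ (u v : V) (_ : G.Walk u v) (e e' : G.Dart), e.fst = u → e'.fst = v →
      g e = g e' := by
    intro u v p
    induction p with
    | nil => intro e e' h h'; exact hrot e e' (h.trans h'.symm)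
    | @cons a b c hab p ih =>
      intro e e' h h'
      rw [hrot e ⟨(a, b), hab⟩ h, hedge]
      exact ih _ e' rfl h'
  obtain ⟨p⟩ := hconn.preconnected d.fst d'.fst
  exact hwalk _ _ p d d' rfl rfl

/-- Summing a function over the edges at `v` is the same as summing over the darts leaving `v`. -/
lemma sum_edges_eq_sum_darts [Fintype G.edgeSet] [Fintype G.Dart] [DecidableEq V]
    (v : V) (h : G.edgeSet → ZMod 2) :
    ∑ e : G.edgeSet, (if v ∈ e.1 then h e else 0) =
      ∑ d : G.Dart with d.fst = v, h ⟨d.edge, d.edge_mem⟩ := by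
  rw [← Finset.sum_filter]
  symm
  refine Finset.sum_bij (fun d _ => (⟨d.edge, d.edge_mem⟩ : G.edgeSet)) ?_ ?_ ?_ ?_
  · intro d hd
    simp only [Finset.mem_filter, Finset.mem_univ, true_and] at hd ⊢
    rw [← hd]
    exact Sym2.mem_mk_left _ _
  · intro d hd d' hd' h
    simp only [Finset.mem_filter, Finset.mem_univ, true_and] at hd hd'
    rcases (dart_edge_eq_iff d d').1 (congrArg Subtype.val h) with h | h
    · exact h
    · exfalso
      have h1 : d.fst = d'.snd := by rw [h]; rfl
      exact d'.adj.ne (hd'.trans (hd.symm.trans h1))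
  · rintro ⟨e, he⟩ hv
    simp only [Finset.mem_filter, Finset.mem_univ, true_and] at hv
    obtain ⟨y, rfl⟩ := Sym2.mem_iff_exists.1 hv
    exact ⟨⟨(v, y), he⟩, by simp, rfl⟩
  · intro d _
    rfl

variable [Fintype V]

open Classical in
/-- On the sphere, every mod 2 cycle is the boundary of a set of faces. -/
theorem CombEmbedding.exists_faceFunction (E : CombEmbedding G) (hconn : G.Connected)
    (heuler : (Fintype.card V : ℤ) - (G.edgeSet.ncard : ℤ) + (E.numFaces : ℤ) = 2)
    (w : G.edgeSet → ZMod 2)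
    (hw : ∀ v : V, ∑ e : G.edgeSet, (if v ∈ e.1 then w e else 0) = 0) :
    ∃ g : G.Dart → ZMod 2, (∀ d, g (E.facePerm d) = g d) ∧
      ∀ d : G.Dart, g d + g d.symm = w ⟨d.edge, d.edge_mem⟩ := by
  have hrep : ∀ e : G.edgeSet, ∃ d : G.Dart, d.edge = e.1 := by
    rintro ⟨e, he⟩
    induction e with
    | h x y => exact ⟨⟨(x, y), he⟩, rfl⟩
  choose rep hrep using hrep
  have hsymm : ∀ (F : G.Dart → ZMod 2) (d : G.Dart),
      F (rep ⟨d.edge, d.edge_mem⟩) + F (rep ⟨d.edge, d.edge_mem⟩).symm = F d + F d.symm := by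
    intro F d
    rcases (dart_edge_eq_iff _ _).1 (hrep ⟨d.edge, d.edge_mem⟩) with h | h
    · rw [h]
    · rw [h, Dart.symm_symm, add_comm]
  let B : (Quotient E.faceSetoid → ZMod 2) →ₗ[ZMod 2] (G.edgeSet → ZMod 2) :=
    { toFun := fun g e => g (Quotient.mk _ (rep e)) + g (Quotient.mk _ (rep e).symm)
      map_add' := by intro g g'; ext e; simp only [Pi.add_apply]; ring
      map_smul' := by intro c g; ext e; simp [mul_add] }
  let M : Matrix V G.edgeSet (ZMod 2) := Matrix.of fun v e => if v ∈ e.1 then 1 else 0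
  have hM : ∀ x v, M.mulVecLin x v = ∑ e : G.edgeSet, (if v ∈ e.1 then x e else 0) := by
    intro x v
    simp [M, Matrix.mulVec, dotProduct]
  have hle : LinearMap.range B ≤ LinearMap.ker M.mulVecLin := by
    rintro _ ⟨g, rfl⟩
    rw [LinearMap.mem_ker]
    ext v
    rw [hM, sum_edges_eq_sum_darts]
    have h1 : ∀ d : G.Dart, B g ⟨d.edge, d.edge_mem⟩ =
        g (Quotient.mk _ d) + g (Quotient.mk _ (E.rot d)) := by
      intro d
      rw [E.rot_eq_facePerm_symm, E.quotient_facePerm]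
      exact hsymm (fun d => g (Quotient.mk _ d)) d
    simp only [h1, Finset.sum_add_distrib, Pi.zero_apply]
    have h2 : ∑ d : G.Dart with d.fst = v, g (Quotient.mk _ (E.rot d)) =
        ∑ d : G.Dart with d.fst = v, g (Quotient.mk E.faceSetoid d) := by
      refine Finset.sum_equiv E.rot ?_ (fun _ _ => rfl)
      intro d
      simp only [Finset.mem_filter, Finset.mem_univ, true_and]
      rw [show (E.rot d).fst = d.fst from E.rot_fst d]
    rw [h2]
    exact CharTwo.add_self_eq_zero _
  have hkerB : Module.finrank (ZMod 2) (LinearMap.ker B) ≤ 1 := by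
    refine le_trans (Submodule.finrank_mono
      (t := Submodule.span (ZMod 2) {(fun _ => 1 : Quotient E.faceSetoid → ZMod 2)}) ?_)
      ((finrank_span_le_card _).trans (by simp))
    intro g hg
    rw [LinearMap.mem_ker] at hg
    have hedge : ∀ d : G.Dart, g (Quotient.mk _ d) = g (Quotient.mk _ d.symm) := by
      intro d
      have h1 := hsymm (fun d => g (Quotient.mk _ d)) d
      have h2 : B g ⟨d.edge, d.edge_mem⟩ = 0 := by rw [hg]; rfl
      exact CharTwo.add_eq_zero.1 (h1.symm.trans h2)
    have hconst := E.faceFunction_const hconn (g := fun d => g (Quotient.mk _ d))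
      (fun d => by rw [E.quotient_facePerm]) hedge
    rw [Submodule.mem_span_singleton]
    rcases isEmpty_or_nonempty G.Dart with hD | ⟨⟨d₀⟩⟩
    · refine ⟨0, ?_⟩
      ext q
      induction q using Quotient.inductionOn with
      | h d => exact hD.elim d
    · refine ⟨g (Quotient.mk _ d₀), ?_⟩
      ext q
      induction q using Quotient.inductionOn with
      | h d => simpa using hconst d₀ d
  have hkerM : Module.finrank (ZMod 2) (LinearMap.ker M.transpose.mulVecLin) ≤ 1 := by
    refine le_trans (Submodule.finrank_mono
      (t := Submodule.span (ZMod 2) {(fun _ => 1 : V → ZMod 2)}) ?_)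
      ((finrank_span_le_card _).trans (by simp))
    intro h hh
    rw [LinearMap.mem_ker] at hh
    have hadj : ∀ x y, G.Adj x y → h x = h y := by
      intro x y hxy
      have h1 : M.transpose.mulVecLin h ⟨s(x, y), hxy⟩ = 0 := by rw [hh]; rfl
      have h2 : M.transpose.mulVecLin h ⟨s(x, y), hxy⟩ = h x + h y := by
        simp only [M, Matrix.mulVecLin_apply, Matrix.mulVec, dotProduct, Matrix.transpose_apply,
          Matrix.of_apply, ite_mul, one_mul, zero_mul, Sym2.mem_iff]
        rw [← Finset.sum_filter]
        have : (Finset.univ.filter fun v : V => v = x ∨ v = y) = {x, y} := by ext; simp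
        rw [this, Finset.sum_pair hxy.ne]
      exact CharTwo.add_eq_zero.1 (h2.symm.trans h1)
    have hconst : ∀ x y, h x = h y := by
      intro x y
      obtain ⟨p⟩ := hconn.preconnected x y
      induction p with
      | nil => rfl
      | cons hab _ ih => exact (hadj _ _ hab).trans ih
    rw [Submodule.mem_span_singleton]
    obtain ⟨v₀⟩ := hconn.nonempty
    refine ⟨h v₀, ?_⟩
    ext v
    simpa using hconst v₀ v
  have hB := LinearMap.finrank_range_add_finrank_ker B
  have hM1 := LinearMap.finrank_range_add_finrank_ker M.mulVecLin
  have hM2 := LinearMap.finrank_range_add_finrank_ker M.transpose.mulVecLin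
  have hrank : Module.finrank (ZMod 2) (LinearMap.range M.transpose.mulVecLin) =
      Module.finrank (ZMod 2) (LinearMap.range M.mulVecLin) := Matrix.rank_transpose M
  simp only [Module.finrank_fintype_fun_eq_card] at hB hM1 hM2
  have hE : G.edgeSet.ncard = Fintype.card G.edgeSet := by
    rw [← Nat.card_coe_set_eq, Nat.card_eq_fintype_card]
  have hF : E.numFaces = Fintype.card (Quotient E.faceSetoid) := by
    rw [CombEmbedding.numFaces, Nat.card_eq_fintype_card]
  have heq := Submodule.eq_of_le_of_finrank_le hle (by omega)
  have hmem : w ∈ LinearMap.range B := by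
    rw [heq, LinearMap.mem_ker]
    ext v
    rw [hM]
    exact hw v
  obtain ⟨g, hg⟩ := hmem
  refine ⟨fun d => g (Quotient.mk _ d), fun d => congrArg g (E.quotient_facePerm d), fun d => ?_⟩
  rw [← hg]
  exact (hsymm (fun d => g (Quotient.mk _ d)) d).symm

open Classical in
/-- The mod 2 boundary of a walk consists of its two ends. -/
lemma sum_count_edges {u v : V} (p : G.Walk u v) (x : V) :
    ∑ e : G.edgeSet, (if x ∈ e.1 then (p.edges.count e.1 : ZMod 2) else 0) =
      (if x = u then 1 else 0) + (if x = v then 1 else 0) := by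
  induction p with
  | nil => simp [CharTwo.add_self_eq_zero]
  | @cons a b c hab p ih =>
    have h1 : ∀ e : G.edgeSet,
        (if x ∈ e.1 then ((Walk.cons hab p).edges.count e.1 : ZMod 2) else 0) =
        (if x ∈ e.1 then (p.edges.count e.1 : ZMod 2) else 0) +
          (if e = ⟨s(a, b), hab⟩ then (if x = a ∨ x = b then 1 else 0) else 0) := by
      intro e
      rw [Walk.edges_cons, List.count_cons]
      by_cases he : e = ⟨s(a, b), hab⟩
      · subst he
        by_cases hx : x = a ∨ x = b <;> simp [hx]
      · have he' : ¬ s(a, b) = e.1 := fun h => he (Subtype.ext h.symm)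
        simp [he, he']
    simp only [h1, Finset.sum_add_distrib, ih, Finset.sum_ite_eq', Finset.mem_univ, if_true]
    have hne := hab.ne
    have h2 : (1 : ZMod 2) + 1 = 0 := by decide
    by_cases hxa : x = a
    · have hxb : x ≠ b := fun h => hne (hxa.symm.trans h)
      simp [hxa, hne, add_comm]
    · by_cases hxb : x = b
      · have : (1 : ZMod 2) + (if b = c then 1 else 0) + 1 = (if b = c then 1 else 0) := by
          rw [add_right_comm, h2, zero_add]
        simpa [hxb, hne.symm] using this
      · simp [hxa, hxb]

open Classical in
/-- A mod 2 Jordan curve theorem: the faces of a spherical embedding can be two-coloured so that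
the colour changes across precisely the edges traversed an odd number of times by a given
closed walk. -/
theorem CombEmbedding.exists_side (E : CombEmbedding G) (hconn : G.Connected)
    (heuler : (Fintype.card V : ℤ) - (G.edgeSet.ncard : ℤ) + (E.numFaces : ℤ) = 2)
    {u : V} (c : G.Walk u u) :
    ∃ g : G.Dart → ZMod 2, (∀ d, g (E.facePerm d) = g d) ∧
      ∀ d : G.Dart, g d + g d.symm = (c.edges.count d.edge : ZMod 2) :=
  E.exists_faceFunction hconn heuler (fun e => (c.edges.count e.1 : ZMod 2)) fun v => by
    rw [sum_count_edges, CharTwo.add_self_eq_zero]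

end FaceFunctions

section FaceSteps

variable {V : Type} {G : SimpleGraph V}

/-- The dart from `x` to `y` is followed by the dart from `y` to `z` on a facial walk. -/
def CombEmbedding.FaceStep (E : CombEmbedding G) (x y z : V) : Prop :=
  ∃ (h : G.Adj x y) (h' : G.Adj y z), E.facePerm ⟨(x, y), h⟩ = ⟨(y, z), h'⟩

namespace CombEmbedding

variable {E : CombEmbedding G} {x x' y z z' : V}

lemma facePerm_fst (E : CombEmbedding G) (d : G.Dart) : (E.facePerm d).fst = d.snd :=
  E.rot_fst d.symm

lemma faceStep_facePerm (E : CombEmbedding G) (h : G.Adj x y) :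
    E.FaceStep x y (E.facePerm ⟨(x, y), h⟩).snd := by
  have h1 : (E.facePerm ⟨(x, y), h⟩).fst = y := E.facePerm_fst _
  refine ⟨h, ?_, ?_⟩
  · have h2 := (E.facePerm ⟨(x, y), h⟩).adj
    rwa [h1] at h2
  · exact Dart.ext _ _ (Prod.ext h1 rfl)

lemma exists_faceStep (E : CombEmbedding G) (h : G.Adj x y) : ∃ z, E.FaceStep x y z :=
  ⟨_, E.faceStep_facePerm h⟩

lemma exists_faceStep_to (E : CombEmbedding G) (h : G.Adj y z) : ∃ x, E.FaceStep x y z := by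
  set d := E.facePerm.symm ⟨(y, z), h⟩ with hd
  have h1 : E.facePerm d = ⟨(y, z), h⟩ := by simp [hd]
  have h2 : d.snd = y := by rw [← E.facePerm_fst, h1]
  have h3 : G.Adj d.fst y := by rw [← h2]; exact d.adj
  refine ⟨d.fst, h3, h, ?_⟩
  rw [← h1]
  congr 1
  exact Dart.ext _ _ (Prod.ext rfl h2.symm)

lemma FaceStep.adj_left (h : E.FaceStep x y z) : G.Adj x y := h.1

lemma FaceStep.adj_right (h : E.FaceStep x y z) : G.Adj y z := h.2.1

lemma FaceStep.right_unique (h : E.FaceStep x y z) (h' : E.FaceStep x y z') : z = z' := by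
  obtain ⟨_, _, h⟩ := h
  obtain ⟨_, _, h'⟩ := h'
  exact congrArg (fun d : G.Dart => d.snd) (h.symm.trans h')

lemma FaceStep.left_unique (h : E.FaceStep x y z) (h' : E.FaceStep x' y z) : x = x' := by
  obtain ⟨_, _, h⟩ := h
  obtain ⟨_, _, h'⟩ := h'
  exact congrArg (fun d : G.Dart => d.fst) (E.facePerm.injective (h.trans h'.symm))

lemma FaceStep.rotate (h : E.FaceStep x y z)
    (hcube : (E.facePerm ^ 3) ⟨(x, y), h.adj_left⟩ = ⟨(x, y), h.adj_left⟩) :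
    E.FaceStep y z x := by
  obtain ⟨h1, h2, h3⟩ := h
  have h4 := E.faceStep_facePerm h2
  set t := (E.facePerm ⟨(y, z), h2⟩).snd
  obtain ⟨_, h5, h6⟩ := h4
  have h7 : E.facePerm ⟨(z, t), h5⟩ = ⟨(x, y), h1⟩ := by
    rw [← h6, ← h3]
    simpa [pow_succ, Equiv.Perm.mul_apply] using hcube
  have h8 : x = t := by
    have := E.facePerm_fst ⟨(z, t), h5⟩
    rw [h7] at this
    exact this
  rw [h8]
  exact ⟨h2, h5, h6⟩

/-- A set of vertices containing a neighbour of `y` and closed under the rotation at `y` contains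
all neighbours of `y`. -/
lemma mem_of_adj_of_closed (E : CombEmbedding G) {S : Set V} {s n : V} (hs : G.Adj y s)
    (hsS : s ∈ S) (hclosed : ∀ t ∈ S, ∀ z, E.FaceStep t y z → z ∈ S) (hn : G.Adj y n) :
    n ∈ S := by
  refine E.rot_induction (P := fun d => d.snd ∈ S) (d := ⟨(y, s), hs⟩) (d' := ⟨(y, n), hn⟩)
    rfl hsS ?_
  rintro ⟨⟨y', t⟩, ht⟩ hy htS
  obtain rfl : y' = y := hy
  rw [E.rot_eq_facePerm_symm]
  exact hclosed t htS _ (E.faceStep_facePerm ht.symm)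

lemma apply_eq_of_faceStep {g : G.Dart → ZMod 2} (hface : ∀ d, g (E.facePerm d) = g d)
    (h : E.FaceStep x y z) :
    g ⟨(y, z), h.adj_right⟩ = g ⟨(x, y), h.adj_left⟩ := by
  obtain ⟨h1, h2, h3⟩ := h
  exact (congrArg g h3.symm).trans (hface ⟨(x, y), h1⟩)

end CombEmbedding

end FaceSteps

section OuterAngles

variable {A : Type} [Fintype A] (N : NearTriangulation A)

lemma NearTriangulation.apply_eq_of_isOuter {g : N.graph.Dart → ZMod 2}
    (hface : ∀ d, g (N.emb.facePerm d) = g d) {d d' : N.graph.Dart} (hd : N.isOuter d)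
    (hd' : N.isOuter d') : g d = g d' := by
  obtain ⟨n, rfl⟩ := N.outer_single d d' hd hd'
  have key : ∀ m : ℕ, g ((N.emb.facePerm ^ m) d) = g d := by
    intro m
    induction m with
    | zero => rfl
    | succ m ih => rw [pow_succ', Equiv.Perm.mul_apply, hface, ih]
  exact (key n).symm

/-- Two distinct outer darts ending at `v` start in different components of the graph with `v`
deleted. -/
theorem NearTriangulation.not_reachable_of_isOuter {v a b : A} (ha : N.graph.Adj a v)
    (hb : N.graph.Adj b v) (hao : N.isOuter ⟨(a, v), ha⟩) (hbo : N.isOuter ⟨(b, v), hb⟩)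
    (hab : a ≠ b) :
    ¬ (N.graph.induce {w : A | w ≠ v}).Reachable ⟨a, ha.ne⟩ ⟨b, hb.ne⟩ := by
  classical
  rintro ⟨p⟩
  have heuler := N.euler.resolve_left
    (Fintype.one_lt_card_iff.2 ⟨a, b, hab⟩).ne'
  let q : N.graph.Walk a b := p.map (Embedding.induce {w : A | w ≠ v}).toHom
  have hq : v ∉ q.support := by
    intro h
    obtain ⟨w, _, hw⟩ := List.mem_map.1 (Walk.support_map _ p ▸ h)
    exact w.2 hw
  obtain ⟨g, hface, hg⟩ := N.emb.exists_side N.conn heuler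
    (Walk.cons ha.symm (q.concat hb))
  have hcount : ∀ y, (Walk.cons ha.symm (q.concat hb)).edges.count s(v, y) =
      (if a = y then 1 else 0) + (if b = y then 1 else 0) := by
    intro y
    have h0 : q.edges.count s(v, y) = 0 :=
      List.count_eq_zero.2 fun h => hq (q.fst_mem_support_of_mem_edges h)
    rw [Walk.edges_cons, Walk.edges_concat, List.concat_eq_append, List.count_cons,
      List.count_append, h0, List.count_singleton, Sym2.eq_swap (a := b)]
    simp [add_comm, ha.ne, hb.ne]
  have hbv : g ⟨(v, b), hb.symm⟩ = g ⟨(a, v), ha⟩ := by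
    refine N.emb.rot_induction (P := fun d => g d = g ⟨(a, v), ha⟩)
      (d := N.emb.rot ⟨(v, a), ha.symm⟩) (d' := ⟨(v, b), hb.symm⟩) (N.emb.rot_fst _) ?_ ?_
    · rw [N.emb.rot_eq_facePerm_symm, hface]
      rfl
    · rintro ⟨⟨v', y⟩, hy⟩ hv' h
      obtain rfl : v' = v := hv'.trans (N.emb.rot_fst _)
      rw [N.emb.rot_eq_facePerm_symm, hface]
      by_cases hay : a = y
      · subst hay; rfl
      by_cases hby : b = y
      · subst hby; exact N.apply_eq_of_isOuter hface hbo hao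
      have h1 := hg ⟨(v', y), hy⟩
      rw [show Dart.edge ⟨(v', y), hy⟩ = s(v', y) from rfl, hcount, if_neg hay, if_neg hby] at h1
      rw [← h]
      exact (CharTwo.add_eq_zero.1 (by simpa using h1)).symm
  have h1 := hg ⟨(v, b), hb.symm⟩
  rw [show Dart.edge ⟨(v, b), hb.symm⟩ = s(v, b) from rfl, hcount, if_neg hab, if_pos rfl, hbv,
    show g (Dart.symm ⟨(v, b), hb.symm⟩) = g ⟨(a, v), ha⟩ from
      N.apply_eq_of_isOuter hface hbo hao, CharTwo.add_self_eq_zero] at h1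
  simp at h1

lemma NearTriangulation.isCutVertex_of_isOuter {v a b : A} (ha : N.graph.Adj a v)
    (hb : N.graph.Adj b v) (hao : N.isOuter ⟨(a, v), ha⟩) (hbo : N.isOuter ⟨(b, v), hb⟩)
    (hab : a ≠ b) : IsCutVertex N.graph v := by
  classical
  have h1 : Nat.card N.graph.ConnectedComponent ≤ 1 := by
    have := N.conn.preconnected.subsingleton_connectedComponent
    exact Finite.card_le_one_iff_subsingleton.2 this
  refine h1.trans_lt (Finite.one_lt_card_iff_nontrivial.2 ⟨?_⟩)
  refine ⟨connectedComponentMk _ ⟨a, ha.ne⟩, connectedComponentMk _ ⟨b, hb.ne⟩, fun h => ?_⟩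
  exact N.not_reachable_of_isOuter ha hb hao hbo hab (ConnectedComponent.exact h)

/-- At most two outer darts end at a vertex of a configuration. -/
lemma Configuration.eq_of_isOuter (C : Configuration A) {v a b c : A} (ha : C.graph.Adj a v)
    (hb : C.graph.Adj b v) (hc : C.graph.Adj c v) (hao : C.isOuter ⟨(a, v), ha⟩)
    (hbo : C.isOuter ⟨(b, v), hb⟩) (hco : C.isOuter ⟨(c, v), hc⟩) (hab : a ≠ b) :
    c = a ∨ c = b := by
  by_contra! hcon
  have hcut := C.isCutVertex_of_isOuter ha hb hao hbo hab
  obtain ⟨K, L, -, hKL⟩ := Nat.card_eq_two_iff.1 (C.cut_cond v hcut).1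
  have hmem : ∀ M, M = K ∨ M = L := fun M => by
    have : M ∈ ({K, L} : Set _) := hKL ▸ Set.mem_univ M
    simpa using this
  have key : ∀ P Q R : (C.graph.induce {w : A | w ≠ v}).ConnectedComponent,
      P ≠ Q → R ≠ P → R ≠ Q → False := by
    intro P Q R
    rcases hmem P with hP | hP <;> rcases hmem Q with hQ | hQ <;> rcases hmem R with hR | hR <;>
      simp [hP, hQ, hR]
  exact key _ _ _
    (fun h => C.not_reachable_of_isOuter ha hb hao hbo hab (ConnectedComponent.exact h))
    (fun h => C.not_reachable_of_isOuter hc ha hco hao hcon.1 (ConnectedComponent.exact h))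
    (fun h => C.not_reachable_of_isOuter hc hb hco hbo hcon.2 (ConnectedComponent.exact h))

end OuterAngles

section Containment

variable {A V : Type} [Fintype A] [Fintype V] {C : Configuration A} {T : PlaneTriangulation V}
  {f : A → V}

lemma PlaneTriangulation.rotate_faceStep (T : PlaneTriangulation V) {x y z : V}
    (h : T.emb.FaceStep x y z) : T.emb.FaceStep y z x :=
  h.rotate (T.faces_tri _).1

lemma NearTriangulation.rotate_faceStep (N : NearTriangulation A) {x y z : A}
    (h : N.emb.FaceStep x y z) (hin : ¬ N.isOuter ⟨(x, y), h.adj_left⟩) :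
    N.emb.FaceStep y z x :=
  h.rotate (N.inner_tri _ hin).1

namespace IsContainMap

lemma adj (hf : IsContainMap C T f) {a b : A} (h : C.graph.Adj a b) : T.graph.Adj (f a) (f b) :=
  hf.2.1.1 h

lemma vdeg_eq (hf : IsContainMap C T f) (v : A) : vdeg T.graph (f v) = C.δ v :=
  hf.2.1.2.1 v

lemma exists_faceStep (hf : IsContainMap C T f) {a b : A} (h : C.graph.Adj a b)
    (hin : ¬ C.isOuter ⟨(a, b), h⟩) :
    ∃ c, C.graph.Adj b c ∧ C.graph.Adj c a ∧ T.emb.FaceStep (f a) (f b) (f c) := by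
  obtain ⟨-, ⟨hadj, -, hface⟩, -⟩ := hf
  obtain ⟨c, hc⟩ := C.emb.exists_faceStep h
  have hca := (C.rotate_faceStep hc hin).adj_right
  obtain ⟨h1, h2, h3⟩ := hc
  have h4 := hface _ hin
  rw [h3] at h4
  exact ⟨c, h2, hca, hadj h1, hadj h2, h4⟩

lemma isOuter_of_faceStep (hf : IsContainMap C T f) {c v : A} {z : V} (hc : C.graph.Adj c v)
    (hz : T.emb.FaceStep (f c) (f v) z) (hzS : z ∉ f '' C.graph.neighborSet v) :
    C.isOuter ⟨(c, v), hc⟩ := by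
  by_contra hin
  obtain ⟨b, hvb, -, hb⟩ := hf.exists_faceStep hc hin
  exact hzS ⟨b, hvb, hb.right_unique hz⟩

lemma ncard_image_neighborSet (hf : IsContainMap C T f) (v : A) :
    (f '' C.graph.neighborSet v).ncard = vdeg C.graph v :=
  Set.ncard_image_of_injective _ hf.1

lemma vdeg_lt (hf : IsContainMap C T f) {a v : A} (ha : C.graph.Adj a v)
    (hao : C.isOuter ⟨(a, v), ha⟩) : vdeg C.graph v < vdeg T.graph (f v) := by
  rw [hf.vdeg_eq]
  exact C.delta_outer v (Or.inr ⟨_, C.outer_closed _ hao, C.emb.facePerm_fst _⟩)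

/-- If two edges of `C` at `v` are consecutive around `f v`, the angle between them is not in the
outer face of `C`. -/
theorem not_isOuter_of_faceStep (hf : IsContainMap C T f) {a v b : A} (ha : C.graph.Adj a v)
    (hb : C.graph.Adj v b) (hstep : T.emb.FaceStep (f a) (f v) (f b)) :
    ¬ C.isOuter ⟨(a, v), ha⟩ := by
  intro hao
  have hlt := hf.vdeg_lt ha hao
  set S := f '' C.graph.neighborSet v with hS
  have hScard : S.ncard = vdeg C.graph v := hf.ncard_image_neighborSet v
  have haS : f a ∈ S := ⟨a, ha.symm, rfl⟩
  have hbS : f b ∈ S := ⟨b, hb, rfl⟩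
  have hSsub : S ⊆ T.graph.neighborSet (f v) := by
    rintro _ ⟨c, hc, rfl⟩
    exact hf.adj hc
  have hex : ∃ e, ∃ he : C.graph.Adj e v, C.isOuter ⟨(e, v), he⟩ ∧ e ≠ a := by
    by_contra! hcon
    have hsub : T.graph.neighborSet (f v) ⊆ S := by
      intro n hn
      refine T.emb.mem_of_adj_of_closed (hf.adj ha.symm) haS ?_ hn
      rintro _ ⟨c, hc, rfl⟩ z hz
      by_contra hzS
      obtain rfl := hcon c hc.symm (hf.isOuter_of_faceStep hc.symm hz hzS)
      exact hzS (hz.right_unique hstep ▸ hbS)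
    have := Set.ncard_le_ncard hsub (Set.toFinite _)
    rw [hScard] at this
    exact absurd hlt (not_lt.2 this)
  obtain ⟨e, he, heo, hea⟩ := hex
  have hcut := C.isCutVertex_of_isOuter ha he hao heo hea.symm
  have hpre : ∀ p q : V, T.graph.Adj (f v) p → T.graph.Adj (f v) q → p ∉ S → q ∉ S → p ≠ q →
      (∀ r, T.graph.Adj (f v) r → r ∉ S → r = p ∨ r = q) → T.emb.FaceStep (f e) (f v) p := by
    intro p q hp hq hpS hqS hpq hall
    obtain ⟨r, hr⟩ := T.emb.exists_faceStep_to hp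
    have hrS : r ∈ S := by
      by_contra hrS
      rcases hall r hr.adj_left.symm hrS with rfl | rfl
      · have : f a ∈ ({r} : Set V) := by
          refine T.emb.mem_of_adj_of_closed (S := {r}) hp rfl ?_ (hf.adj ha.symm)
          rintro _ rfl z hz
          exact hz.right_unique hr
        rw [Set.mem_singleton_iff] at this
        exact hpS (this ▸ haS)
      · refine hf.2.2 v hcut ⟨(f v, r), hq⟩ ⟨(f v, p), hp⟩ rfl rfl ?_ ?_ ?_ ?_
        · rintro ⟨x, y, hxy, h⟩
          obtain ⟨h1, h2⟩ := Prod.ext_iff.1 h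
          obtain rfl := hf.1 h1
          exact hqS ⟨y, hxy, h2.symm⟩
        · rintro ⟨x, y, hxy, h⟩
          obtain ⟨h1, h2⟩ := Prod.ext_iff.1 h
          obtain rfl := hf.1 h1
          exact hpS ⟨y, hxy, h2.symm⟩
        · intro h
          exact hpq (congrArg (fun d : T.graph.Dart => d.snd) h).symm
        · obtain ⟨_, _, h⟩ := hr
          rw [T.emb.rot_eq_facePerm_symm]
          exact h
    obtain ⟨c, hc, rfl⟩ := hrS
    have hco := hf.isOuter_of_faceStep hc.symm hr hpS
    rcases C.eq_of_isOuter ha he hc.symm hao heo hco hea.symm with rfl | rfl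
    · exact absurd (hr.right_unique hstep ▸ hbS) hpS
    · exact hr
  have hdiff : (T.graph.neighborSet (f v) \ S).ncard = 2 := by
    have h1 : (T.graph.neighborSet (f v)).ncard = vdeg C.graph v + 2 :=
      (hf.vdeg_eq v).trans (C.cut_cond v hcut).2
    rw [Set.ncard_sdiff hSsub (Set.toFinite _), h1, hScard]
    omega
  obtain ⟨p, q, hpq, hset⟩ := Set.ncard_eq_two.1 hdiff
  have hp : p ∈ T.graph.neighborSet (f v) \ S := by rw [hset]; simp
  have hq : q ∈ T.graph.neighborSet (f v) \ S := by rw [hset]; simp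
  have hall : ∀ r, T.graph.Adj (f v) r → r ∉ S → r = p ∨ r = q := by
    intro r h1 h2
    have : r ∈ T.graph.neighborSet (f v) \ S := ⟨h1, h2⟩
    rw [hset] at this
    simpa using this
  exact hpq ((hpre p q hp.1 hq.1 hp.2 hq.2 hpq hall).right_unique
    (hpre q p hq.1 hp.1 hq.2 hp.2 hpq.symm fun r h1 h2 => (hall r h1 h2).symm))

/-- At a vertex of external degree at least two that is not a cut-vertex, the outer angle of `C`
contains more than one edge of `T`. -/
theorem not_isOuter_of_faceStep_of_faceStep (hf : IsContainMap C T f) {a v b : A} {x : V}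
    (hcut : ¬ IsCutVertex C.graph v) (hdeg : vdeg C.graph v + 2 ≤ C.δ v)
    (ha : C.graph.Adj a v) (hb : C.graph.Adj v b) (hx : T.emb.FaceStep (f a) (f v) x)
    (hxb : T.emb.FaceStep x (f v) (f b)) : ¬ C.isOuter ⟨(a, v), ha⟩ := by
  intro hao
  have hsub : T.graph.neighborSet (f v) ⊆ insert x (f '' C.graph.neighborSet v) := by
    intro n hn
    refine T.emb.mem_of_adj_of_closed (hf.adj ha.symm) (Or.inr ⟨a, ha.symm, rfl⟩) ?_ hn
    rintro t (rfl | ⟨c, hc, rfl⟩) z hz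
    · exact Or.inr ⟨b, hb, hxb.right_unique hz⟩
    · by_contra hzS
      have hco := hf.isOuter_of_faceStep hc.symm hz fun h => hzS (Or.inr h)
      by_cases hca : c = a
      · subst hca
        exact hzS (Or.inl (hz.right_unique hx))
      · exact hcut (C.isCutVertex_of_isOuter hc.symm ha hco hao hca)
  have h1 : vdeg T.graph (f v) ≤ _ := Set.ncard_le_ncard hsub (Set.toFinite _)
  have h2 := Set.ncard_insert_le x (f '' C.graph.neighborSet v)
  rw [hf.ncard_image_neighborSet] at h2
  rw [hf.vdeg_eq] at h1
  omega

end IsContainMap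

open Classical in
/-- If a cycle of length at most five is not obstructing, the triangles on one of its sides use
no vertices outside the cycle, except for a single apex if the length is five. -/
theorem PlaneTriangulation.exists_apex (T : PlaneTriangulation V) {x : V} {c : T.graph.Walk x x}
    (hc : c.IsCycle) (hno : ¬ IsObstructingCycle c) (hlen : c.length ≤ 5) :
    ∃ y, ∀ u v, s(u, v) ∈ c.edges → ∃ t,
      (T.emb.FaceStep u v t ∨ T.emb.FaceStep v u t) ∧
        (t ∈ c.support ∨ (c.length = 5 ∧ t = y)) := by
  obtain ⟨g, hface, hg⟩ := T.emb.exists_side T.conn T.euler c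
  have hoff : ∀ d : T.graph.Dart, d.fst ∉ c.support → g d.symm = g d := by
    rintro ⟨⟨u, v⟩, h⟩ hd
    have h0 : c.edges.count s(u, v) = 0 :=
      List.count_eq_zero.2 fun h => hd (c.fst_mem_support_of_mem_edges h)
    have h1 := hg ⟨(u, v), h⟩
    rw [show Dart.edge ⟨(u, v), h⟩ = s(u, v) from rfl, h0, Nat.cast_zero] at h1
    exact (CharTwo.add_eq_zero.1 h1).symm
  have hside : ∀ d d' : T.graph.Dart, d.fst = d'.fst → d.fst ∉ c.support → g d' = g d := by
    intro d d' hdd' hd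
    refine T.emb.rot_induction (P := fun e => g e = g d) hdd' rfl ?_
    intro e he h
    rw [T.emb.rot_eq_facePerm_symm, hface, hoff e (he ▸ hd), h]
  have h01 : ∀ a : ZMod 2, a ≠ 0 → a = 1 := by decide
  have hsides : ∃ (i : ZMod 2) (y : V), ∀ d : T.graph.Dart, g d = i → d.fst ∉ c.support →
      c.length = 5 ∧ d.fst = y := by
    let S₀ : Set V := {v | v ∉ c.support ∧ ∃ d : T.graph.Dart, d.fst = v ∧ g d = 0}
    let S₁ : Set V := {v | v ∉ c.support ∧ ¬ ∃ d : T.graph.Dart, d.fst = v ∧ g d = 0}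
    have hS₀ : ∀ d : T.graph.Dart, g d = 0 → d.fst ∉ c.support → d.fst ∈ S₀ :=
      fun d hd hdc => ⟨hdc, d, rfl, hd⟩
    have hS₁ : ∀ d : T.graph.Dart, g d = 1 → d.fst ∉ c.support → d.fst ∈ S₁ := by
      refine fun d hd hdc => ⟨hdc, ?_⟩
      rintro ⟨d', hd', h⟩
      rw [hside d d' hd'.symm hdc, hd] at h
      exact one_ne_zero h
    have hnot : ¬ ((c.length ≤ 4 ∧ S₀.Nonempty ∧ S₁.Nonempty) ∨
        (c.length = 5 ∧ 2 ≤ S₀.ncard ∧ 2 ≤ S₁.ncard)) := by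
      refine fun h => hno ⟨hc, S₀, S₁, ?_, fun v hv => hv.1, fun v hv => hv.1, ?_, ?_, h⟩
      · intro v hv
        by_cases hd : ∃ d : T.graph.Dart, d.fst = v ∧ g d = 0
        · exact Or.inl ⟨hv, hd⟩
        · exact Or.inr ⟨hv, hd⟩
      · exact Set.disjoint_left.2 fun v h h' => h'.2 h.2
      · rintro a ⟨ha, d, hd, hgd⟩ b ⟨hb, hb'⟩ hab
        refine hb' ⟨⟨(b, a), hab.symm⟩, rfl, ?_⟩
        rw [← hgd, ← hside d ⟨(a, b), hab⟩ hd (hd ▸ ha)]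
        exact hoff ⟨(a, b), hab⟩ ha
    have hfew : ∀ S : Set V, (c.length ≤ 4 → ¬ S.Nonempty) → (c.length = 5 → S.ncard < 2) →
        ∃ y, ∀ v ∈ S, c.length = 5 ∧ v = y := by
      intro S h4 h5
      rcases S.eq_empty_or_nonempty with rfl | ⟨y, hy⟩
      · exact ⟨x, by simp⟩
      · have hl : c.length = 5 := by
          by_contra hl
          exact h4 (by omega) ⟨y, hy⟩
        exact ⟨y, fun v hv => ⟨hl, (Set.ncard_le_one (Set.toFinite _)).1
          (Nat.le_of_lt_succ (h5 hl)) v hv y hy⟩⟩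
    by_cases hsmall : (c.length ≤ 4 → ¬ S₀.Nonempty) ∧ (c.length = 5 → S₀.ncard < 2)
    · obtain ⟨y, hy⟩ := hfew S₀ hsmall.1 hsmall.2
      exact ⟨0, y, fun d hd hdc => hy _ (hS₀ d hd hdc)⟩
    · obtain ⟨y, hy⟩ := hfew S₁ (by grind) (by grind)
      exact ⟨1, y, fun d hd hdc => hy _ (hS₁ d hd hdc)⟩
  obtain ⟨i, y, hy⟩ := hsides
  have hthird : ∀ u v (h : T.graph.Adj u v), g ⟨(u, v), h⟩ = i → ∃ t,
      T.emb.FaceStep u v t ∧ (t ∈ c.support ∨ (c.length = 5 ∧ t = y)) := by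
    intro u v h hi
    obtain ⟨t, ht⟩ := T.emb.exists_faceStep h
    have ht' := T.rotate_faceStep ht
    have h1 : g ⟨(t, u), ht'.adj_right⟩ = i := by
      rw [CombEmbedding.apply_eq_of_faceStep hface ht',
        CombEmbedding.apply_eq_of_faceStep hface ht, hi]
    exact ⟨t, ht, or_iff_not_imp_left.2 (hy _ h1)⟩
  refine ⟨y, fun u v huv => ?_⟩
  have hadj : T.graph.Adj u v := c.adj_of_mem_edges huv
  have h1 := hg ⟨(u, v), hadj⟩
  rw [show Dart.edge ⟨(u, v), hadj⟩ = s(u, v) from rfl,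
    List.count_eq_one_of_mem hc.isTrail.edges_nodup huv, Nat.cast_one] at h1
  have h2 : ∀ a b j : ZMod 2, a + b = 1 → a = j ∨ b = j := by decide
  rcases h2 _ _ i h1 with h | h
  · obtain ⟨t, ht, ht'⟩ := hthird u v hadj h
    exact ⟨t, Or.inl ht, ht'⟩
  · obtain ⟨t, ht, ht'⟩ := hthird v u hadj.symm h
    exact ⟨t, Or.inr ht, ht'⟩

namespace IsContainMap

/-- The apex of the cycle formed by a path of length at most four in `C` and an edge of `T`
joining its ends. -/
lemma exists_apex (hf : IsContainMap C T f)
    (hno : ¬ ∃ (x : V) (c : T.graph.Walk x x),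
      IsObstructingCycle c ∧ ∀ y ∈ c.support, y ∈ Set.range f)
    {a b : A} {p : C.graph.Walk a b} (hp : p.IsPath) (hlen : p.length ≤ 4)
    (hT : T.graph.Adj (f a) (f b)) (hC : ¬ C.graph.Adj a b) :
    ∃ y, ∀ u v, (s(u, v) = s(a, b) ∨ s(u, v) ∈ p.edges) → ∃ t,
      T.graph.Adj t (f u) ∧ T.graph.Adj t (f v) ∧
      (T.emb.FaceStep (f u) (f v) t ∨ T.emb.FaceStep (f v) (f u) t) ∧
        ((∃ t' ∈ p.support, f t' = t) ∨ (p.length = 4 ∧ t = y)) := by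
  let φ : C.graph →g T.graph := ⟨f, fun h => hf.adj h⟩
  have hcyc : (Walk.cons hT.symm (p.map φ)).IsCycle := by
    rw [Walk.cons_isCycle_iff]
    refine ⟨hp.map hf.1, fun h => ?_⟩
    rw [Walk.edges_map, List.mem_map] at h
    obtain ⟨e, he, hee⟩ := h
    have : e = s(b, a) := Sym2.map.injective hf.1 (hee.trans (Sym2.map_mk ..).symm)
    subst this
    exact hC (p.adj_of_mem_edges he).symm
  have hsupp : ∀ t ∈ (Walk.cons hT.symm (p.map φ)).support, ∃ t' ∈ p.support, f t' = t := by
    intro t ht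
    rw [Walk.support_cons, Walk.support_map, List.mem_cons] at ht
    rcases ht with rfl | ht
    · exact ⟨b, p.end_mem_support, rfl⟩
    · exact List.mem_map.1 ht
  have hnot : ¬ IsObstructingCycle (Walk.cons hT.symm (p.map φ)) := by
    refine fun h => hno ⟨_, _, h, fun y hy => ?_⟩
    obtain ⟨t, -, ht⟩ := hsupp y hy
    exact ⟨t, ht⟩
  obtain ⟨y, hy⟩ := T.exists_apex hcyc hnot (by
    rw [Walk.length_cons, Walk.length_map]
    omega)
  refine ⟨y, fun u v huv => ?_⟩
  obtain ⟨t, ht, ht'⟩ := hy (f u) (f v) (by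
    rw [Walk.edges_cons, List.mem_cons, Walk.edges_map]
    rcases huv with h | h
    · left
      have := congrArg (Sym2.map f) h
      rw [Sym2.map_mk, Sym2.map_mk] at this
      rw [this, Sym2.eq_swap]
    · right
      exact List.mem_map_of_mem (f := Sym2.map f) h)
  refine ⟨t, ?_, ?_, ht, ht'.imp (hsupp t) (by simp)⟩
  · exact ht.elim (fun h => (T.rotate_faceStep h).adj_right) fun h => h.adj_right.symm
  · exact ht.elim (fun h => h.adj_right.symm) fun h => (T.rotate_faceStep h).adj_right

lemma not_adj_of_dist_eq_two (hf : IsContainMap C T f)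
    (hno : ¬ ∃ (x : V) (c : T.graph.Walk x x),
      IsObstructingCycle c ∧ ∀ y ∈ c.support, y ∈ Set.range f)
    {a b : A} (hab : C.graph.dist a b = 2) : ¬ T.graph.Adj (f a) (f b) := by
  intro hT
  have hC : ¬ C.graph.Adj a b := fun h => by
    rw [dist_eq_one_iff_adj.2 h] at hab
    omega
  obtain ⟨p, hp, hlen⟩ := C.conn.exists_path_of_dist a b
  rw [hab] at hlen
  obtain ⟨y, hy⟩ := hf.exists_apex hno hp (by omega) hT hC
  rcases p with _ | ⟨h₁, _ | ⟨h₂, _ | ⟨_, _⟩⟩⟩ <;> simp at hlen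
  rename_i v
  obtain ⟨t, hta, htv, ht, ⟨t', ht', rfl⟩ | h⟩ := hy a v (by simp)
  · obtain rfl : t' = b := by
      simp only [Walk.support_cons, Walk.support_nil, List.mem_cons, List.not_mem_nil,
        or_false] at ht'
      rcases ht' with rfl | rfl | rfl
      · exact absurd rfl hta.ne
      · exact absurd rfl htv.ne
      · rfl
    have key : ∀ c d, C.graph.Adj c v → C.graph.Adj v d →
        T.emb.FaceStep (f c) (f v) (f d) → C.graph.Adj d c := by
      intro c d hc hd h
      obtain ⟨e, -, he, he'⟩ := hf.exists_faceStep hc (hf.not_isOuter_of_faceStep hc hd h)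
      rwa [hf.1 (h.right_unique he')]
    rcases ht with h | h
    · exact hC (key a t' h₁ h₂ h).symm
    · exact hC (key t' a h₂.symm h₁.symm (T.rotate_faceStep (T.rotate_faceStep h)))
  · simp at h

lemma not_adj_of_dist_eq_three (hf : IsContainMap C T f)
    (hno : ¬ ∃ (x : V) (c : T.graph.Walk x x),
      IsObstructingCycle c ∧ ∀ y ∈ c.support, y ∈ Set.range f)
    {a b : A} (hab : C.graph.dist a b = 3) : ¬ T.graph.Adj (f a) (f b) := by
  intro hT
  have hC : ¬ C.graph.Adj a b := fun h => by
    rw [dist_eq_one_iff_adj.2 h] at hab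
    omega
  obtain ⟨p, hp, hlen⟩ := C.conn.exists_path_of_dist a b
  rw [hab] at hlen
  obtain ⟨y, hy⟩ := hf.exists_apex hno hp (by omega) hT hC
  rcases p with _ | ⟨h₁, _ | ⟨h₂, _ | ⟨h₃, _ | ⟨_, _⟩⟩⟩⟩ <;> simp at hlen
  rename_i v w
  have e₁ := dist_eq_one_iff_adj.2 h₁
  have e₂ := dist_eq_one_iff_adj.2 h₂
  have e₃ := dist_eq_one_iff_adj.2 h₃
  have t₁ := C.conn.dist_triangle (u := a) (v := v) (w := b)
  have t₂ := C.conn.dist_triangle (u := v) (v := w) (w := b)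
  have t₃ := C.conn.dist_triangle (u := a) (v := w) (w := b)
  have t₄ := C.conn.dist_triangle (u := a) (v := v) (w := w)
  obtain ⟨t, hta, htb, -, ⟨t', ht', rfl⟩ | h⟩ := hy a b (by simp)
  · simp only [Walk.support_cons, Walk.support_nil, List.mem_cons, List.not_mem_nil,
      or_false] at ht'
    rcases ht' with rfl | rfl | rfl | rfl
    · exact hta.ne rfl
    · exact hf.not_adj_of_dist_eq_two hno (by omega) htb
    · exact hf.not_adj_of_dist_eq_two hno (by omega) hta.symm
    · exact htb.ne rfl
  · simp at h

lemma not_adj_of_dist_eq_four (hf : IsContainMap C T f)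
    (hno : ¬ ∃ (x : V) (c : T.graph.Walk x x),
      IsObstructingCycle c ∧ ∀ y ∈ c.support, y ∈ Set.range f)
    (hdiam : ∀ a b : A, C.graph.dist a b ≤ 4) (hsecond : SecondNbrCond C)
    {a b : A} (hab : C.graph.dist a b = 4) : ¬ T.graph.Adj (f a) (f b) := by
  intro hT
  have hC : ¬ C.graph.Adj a b := fun h => by
    rw [dist_eq_one_iff_adj.2 h] at hab
    omega
  have hdist : ∀ u v : A, T.graph.Adj (f u) (f v) →
      C.graph.dist u v = 1 ∨ C.graph.dist u v = 4 := by
    intro u v h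
    have h0 : C.graph.dist u v ≠ 0 := fun h0 =>
      h.ne (congrArg f (C.conn.dist_eq_zero_iff.1 h0))
    have h2 : C.graph.dist u v ≠ 2 := fun h2 => hf.not_adj_of_dist_eq_two hno h2 h
    have h3 : C.graph.dist u v ≠ 3 := fun h3 => hf.not_adj_of_dist_eq_three hno h3 h
    have h4 := hdiam u v
    omega
  have tri : ∀ u v w, C.graph.dist u w ≤ C.graph.dist u v + C.graph.dist v w :=
    fun _ _ _ => C.conn.dist_triangle
  obtain ⟨p, hp, hlen, hcond⟩ := hsecond a b hab
  obtain ⟨y, hy⟩ := hf.exists_apex hno hp (by omega) hT hC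
  rcases p with _ | ⟨h₁, _ | ⟨h₂, _ | ⟨h₃, _ | ⟨h₄, _ | ⟨_, _⟩⟩⟩⟩⟩ <;> simp at hlen
  rename_i v₁ v₂ v₃
  have e₁ := dist_eq_one_iff_adj.2 h₁
  have e₂ := dist_eq_one_iff_adj.2 h₂
  have e₃ := dist_eq_one_iff_adj.2 h₃
  have e₄ := dist_eq_one_iff_adj.2 h₄
  have d₀₂ : C.graph.dist a v₂ = 2 := by
    have := tri a v₁ v₂; have := tri a v₂ b; have := tri v₂ v₃ b; omega
  have d₁₃ : C.graph.dist v₁ v₃ = 2 := by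
    have := tri v₁ v₂ v₃; have := tri a v₁ b; have := tri v₁ v₃ b; omega
  have d₂₄ : C.graph.dist v₂ b = 2 := by
    have := tri v₂ v₃ b; have := tri a v₂ b; omega
  have d₀₃ : C.graph.dist a v₃ = 3 := by
    have := tri a v₂ v₃; have := tri a v₃ b; omega
  have d₁₄ : C.graph.dist v₁ b = 3 := by
    have := tri v₁ v₂ b; have := tri a v₁ b; omega
  have hapex : ∀ u v, s(u, v) ∈ [s(a, v₁), s(v₁, v₂), s(v₂, v₃), s(v₃, b)] →
      (∀ t ∈ [a, v₁, v₂, v₃, b], (C.graph.dist t u = 1 ∨ C.graph.dist t u = 4) →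
        (C.graph.dist t v = 1 ∨ C.graph.dist t v = 4) → False) →
      T.graph.Adj y (f u) ∧ T.graph.Adj y (f v) ∧
        (T.emb.FaceStep (f u) (f v) y ∨ T.emb.FaceStep (f v) (f u) y) := by
    intro u v huv hnone
    obtain ⟨t, htu, htv, ht, ⟨t', ht', rfl⟩ | ⟨-, rfl⟩⟩ := hy u v (Or.inr (by simpa using huv))
    · exact (hnone t' (by simpa using ht') (hdist _ _ htu) (hdist _ _ htv)).elim
    · exact ⟨htu, htv, ht⟩
  have c₀₂ := C.graph.dist_comm (u := a) (v := v₂)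
  have c₁₃ := C.graph.dist_comm (u := v₁) (v := v₃)
  have c₂₄ := C.graph.dist_comm (u := v₂) (v := b)
  have c₀₃ := C.graph.dist_comm (u := a) (v := v₃)
  have c₁₄ := C.graph.dist_comm (u := v₁) (v := b)
  obtain ⟨y₀, y₁, s₁⟩ := hapex a v₁ (by simp) (by
    simp only [List.forall_mem_cons, SimpleGraph.dist_self, List.not_mem_nil, false_imp_iff,
      implies_true, and_true]
    omega)
  obtain ⟨-, y₂, s₂⟩ := hapex v₁ v₂ (by simp) (by
    simp only [List.forall_mem_cons, SimpleGraph.dist_self, List.not_mem_nil, false_imp_iff,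
      implies_true, and_true]
    omega)
  obtain ⟨-, y₃, s₃⟩ := hapex v₂ v₃ (by simp) (by
    simp only [List.forall_mem_cons, SimpleGraph.dist_self, List.not_mem_nil, false_imp_iff,
      implies_true, and_true]
    omega)
  obtain ⟨-, y₄, s₄⟩ := hapex v₃ b (by simp) (by
    simp only [List.forall_mem_cons, SimpleGraph.dist_self, List.not_mem_nil, false_imp_iff,
      implies_true, and_true]
    omega)
  have hx : ∀ u ∈ [a, v₁, v₂, v₃, b], ∀ c, C.graph.Adj u c → y ≠ f c := by
    rintro u hu c huc rfl
    have e := dist_eq_one_iff_adj.2 huc.symm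
    have := hdist _ _ y₀
    have := hdist _ _ y₁
    have := hdist _ _ y₂
    have := hdist _ _ y₃
    have := hdist _ _ y₄
    have := tri c a v₁
    have := tri c v₁ v₂
    have := tri c v₂ v₃
    have := tri c v₃ b
    have := tri c v₁ a
    have := tri c v₂ v₁
    have := tri c v₃ v₂
    have := tri c b v₃
    have := tri a c b
    have := C.graph.dist_comm (u := a) (v := c)
    have := dist_eq_one_iff_adj.2 h₁.symm
    have := dist_eq_one_iff_adj.2 h₂.symm
    have := dist_eq_one_iff_adj.2 h₃.symm
    have := dist_eq_one_iff_adj.2 h₄.symm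
    simp only [List.mem_cons, List.not_mem_nil, or_false] at hu
    rcases hu with rfl | rfl | rfl | rfl | rfl <;> omega
  have houter : ∀ u v (h : C.graph.Adj u v), v ∈ [a, v₁, v₂, v₃, b] →
      T.emb.FaceStep (f u) (f v) y → C.isOuter ⟨(u, v), h⟩ := by
    intro u v h hv hs
    by_contra hin
    obtain ⟨c, hvc, -, hc⟩ := hf.exists_faceStep h hin
    exact hx v hv c hvc (hs.right_unique hc)
  have hedge : ∀ u v (_ : C.graph.Adj u v), u ∈ [a, v₁, v₂, v₃, b] → v ∈ [a, v₁, v₂, v₃, b] →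
      (T.emb.FaceStep (f u) (f v) y ∨ T.emb.FaceStep (f v) (f u) y) →
      C.toNearTriangulation.IsOuterEdge u v := by
    rintro u v h hu hv (hs | hs)
    · exact ⟨_, houter u v h hv hs, Or.inl rfl⟩
    · exact ⟨_, houter v u h.symm hu hs, Or.inr rfl⟩
  have hmid : ∀ u v w, C.graph.Adj u v → C.graph.Adj v w → C.graph.dist u w = 2 →
      v ∈ [a, v₁, v₂, v₃, b] →
      (T.emb.FaceStep (f u) (f v) y ∨ T.emb.FaceStep (f v) (f u) y) →
      (T.emb.FaceStep (f v) (f w) y ∨ T.emb.FaceStep (f w) (f v) y) →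
      ¬ IsCutVertex C.graph v → ¬ vdeg C.graph v + 2 ≤ C.δ v := by
    intro u v w huv hvw hd hv hs hs' hcut hdeg
    have hne : f u ≠ f w := fun h => by
      rw [hf.1 h, SimpleGraph.dist_self] at hd
      omega
    have hrot : ∀ {r s t}, T.emb.FaceStep r s t → T.emb.FaceStep t r s := fun h =>
      T.rotate_faceStep (T.rotate_faceStep h)
    rcases hs with hs | hs <;> rcases hs' with hs' | hs'
    · exact hf.not_isOuter_of_faceStep_of_faceStep hcut hdeg huv hvw hs (hrot hs')
        (houter u v huv hv hs)
    · exact hne (hs.left_unique hs')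
    · exact hne ((hrot hs).right_unique (hrot hs'))
    · exact hf.not_isOuter_of_faceStep_of_faceStep hcut hdeg hvw.symm huv.symm hs' (hrot hs)
        (houter w v hvw.symm hv hs')
  rcases hcond with h | ⟨x, hxp, hxa, hxb, hcut, hdeg⟩
  · refine h ?_
    simp only [Walk.darts_cons, Walk.darts_nil, List.forall_mem_cons]
    exact ⟨hedge _ _ h₁ (by simp) (by simp) s₁, hedge _ _ h₂ (by simp) (by simp) s₂,
      hedge _ _ h₃ (by simp) (by simp) s₃, hedge _ _ h₄ (by simp) (by simp) s₄, by simp⟩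
  · simp only [Walk.support_cons, Walk.support_nil, List.mem_cons, List.not_mem_nil,
      or_false] at hxp
    rcases hxp with rfl | rfl | rfl | rfl | rfl
    · exact hxa rfl
    · exact hmid _ _ _ h₁ h₂ d₀₂ (by simp) s₁ s₂ hcut hdeg
    · exact hmid _ _ _ h₂ h₃ d₁₃ (by simp) s₂ s₃ hcut hdeg
    · exact hmid _ _ _ h₃ h₄ d₂₄ (by simp) s₃ s₄ hcut hdeg
    · exact hxb rfl

end IsContainMap

end Containment

end FourColor

open FourColor in
/-- Let `(Z, δ)` be a configuration such that (i) `Z` has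
diameter at most 4, and (ii) any two vertices at `Z`-distance exactly 4 are
joined by a length-4 path which either is not contained in the outer face
boundary, or has an internal vertex which is not a cut-vertex and has external
degree at least 2.  If a planar triangulation `G` contains `(Z, δ)` (via `f`)
and `G` has no obstructing cycle all of whose vertices lie in the copy of `Z`,
then `(Z, δ)` is induced in `G`. -/
theorem contained_configuration_is_induced
    {A V : Type} [Fintype A] [Fintype V]
    (C : Configuration A) (T : PlaneTriangulation V)
    (hdiam : ∀ a b : A, C.graph.dist a b ≤ 4)
    (hsecond : SecondNbrCond C)
    (f : A → V) (hf : IsContainMap C T f)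
    (hno : ¬ ∃ (x : V) (c : T.graph.Walk x x),
      IsObstructingCycle c ∧ ∀ y ∈ c.support, y ∈ Set.range f) :
    ∀ a b : A, T.graph.Adj (f a) (f b) → C.graph.Adj a b := by
  intro a b hT
  by_contra hC
  have h0 : C.graph.dist a b ≠ 0 := fun h => hT.ne (congrArg f (C.conn.dist_eq_zero_iff.1 h))
  have h1 : C.graph.dist a b ≠ 1 := fun h => hC (SimpleGraph.dist_eq_one_iff_adj.1 h)
  have h2 : C.graph.dist a b ≠ 2 := fun h => hf.not_adj_of_dist_eq_two hno h hT
  have h3 : C.graph.dist a b ≠ 3 := fun h => hf.not_adj_of_dist_eq_three hno h hT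
  have h4 : C.graph.dist a b ≠ 4 := fun h =>
    hf.not_adj_of_dist_eq_four hno hdiam hsecond h hT
  have := hdiam a b
  omega
end

section
/- For a planar triangulation G, let V⁻ = {v ∈ V(G) : T(v) < 0} and V⁺ = {v ∈ V(G) : T(v) > 0}. Then Σ_{v ∈ V⁻} d(v) < 31 · 54 · |V⁺|; in particular Σ_{v ∈ V⁻} d(v) = O(|V⁺|). -/
namespace FourColor

open SimpleGraph

theorem vdeg_eq_degree {V : Type} [Fintype V] (G : SimpleGraph V) [DecidableRel G.Adj] (v : V) :
    vdeg G v = G.degree v := by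
  rw [vdeg, ← Nat.card_coe_set_eq, Nat.card_eq_fintype_card, G.card_neighborSet_eq_degree]

/-- The handshake lemma for `vdeg`. -/
theorem sum_vdeg_eq {V : Type} [Fintype V] (G : SimpleGraph V) :
    ∑ v : V, vdeg G v = 2 * G.edgeSet.ncard := by
  classical
  simp only [vdeg_eq_degree, G.sum_degrees_eq_twice_card_edges, ← coe_edgeFinset,
    Set.ncard_coe_finset]

/-- Every face of a plane triangulation contains at least three darts. -/
theorem PlaneTriangulation.three_mul_numFaces_le {V : Type} [Fintype V]
    (T : PlaneTriangulation V) : 3 * T.emb.numFaces ≤ 2 * T.graph.edgeSet.ncard := by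
  classical
  set f := T.emb.facePerm with hf
  have h3 : ∀ d, f (f (f d)) = d := fun d => by
    simpa [pow_succ] using (T.faces_tri d).1
  have h1 : ∀ d, f d ≠ d := fun d => (T.faces_tri d).2
  have h2 : ∀ d, f (f d) ≠ d := fun d h => h1 d (by simpa [h] using h3 d)
  let g : Quotient T.emb.faceSetoid × Fin 3 → T.graph.Dart :=
    fun p => (f ^ (p.2 : ℕ)) p.1.out
  have hg : Function.Injective g := by
    rintro ⟨q, i⟩ ⟨r, j⟩ h
    have hq : ∀ p, Quotient.mk T.emb.faceSetoid (g p) = p.1 := fun p => by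
      have hrel : T.emb.faceSetoid p.1.out (g p) := ⟨(p.2 : ℕ), by simp [g, hf]⟩
      rw [← Quotient.sound hrel, Quotient.out_eq]
    obtain rfl : q = r := by simpa [h] using (hq (q, i)).symm.trans (h ▸ hq (r, j))
    have e1 := h1 q.out
    have e2 := h2 q.out
    have e3 : f (f q.out) ≠ f q.out := fun h => e1 (f.injective h)
    replace h : (f ^ (i : ℕ)) q.out = (f ^ (j : ℕ)) q.out := h
    fin_cases i <;> fin_cases j <;>
      first
      | rfl
      | exact absurd h ‹_›
      | exact absurd h.symm ‹_›
  have hcard := Nat.card_le_card_of_injective g hg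
  rw [Nat.card_prod, Nat.card_eq_fintype_card (α := Fin 3), Fintype.card_fin,
    Nat.card_eq_fintype_card (α := T.graph.Dart),
    T.graph.dart_card_eq_twice_card_edges] at hcard
  rw [← coe_edgeFinset, Set.ncard_coe_finset, CombEmbedding.numFaces, mul_comm]
  exact hcard

/-- Discharging preserves the total charge. -/
theorem sum_finalCharge {V : Type} [Fintype V] (G : SimpleGraph V) (send : V → V → ℤ) :
    ∑ v : V, finalCharge G send v = ∑ v : V, initialCharge G v := by
  simp only [finalCharge, Finset.sum_add_distrib, Finset.sum_sub_distrib]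
  rw [Finset.sum_comm (f := fun v u => send u v), sub_self, add_zero]

theorem PlaneTriangulation.sum_initialCharge_pos {V : Type} [Fintype V]
    (T : PlaneTriangulation V) : 0 < ∑ v : V, initialCharge T.graph v := by
  have hdeg : ∑ v : V, (vdeg T.graph v : ℤ) = 2 * T.graph.edgeSet.ncard := by
    exact_mod_cast sum_vdeg_eq T.graph
  have hfaces := T.three_mul_numFaces_le
  have heuler := T.euler
  simp only [initialCharge, ← Finset.mul_sum, Finset.sum_sub_distrib, hdeg, Finset.sum_const,
    Finset.card_univ, nsmul_eq_mul]
  lia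

end FourColor

open FourColor in
/-- Let `V⁻`, `V⁺` be the sets of vertices of negative,
resp. positive, final charge of a planar triangulation.  Given the facts
(established for the paper's discharging) that all final charges are at most
54 and that `T(v) ≤ −(2/31)·d(v)` whenever `d(v) ≥ 31`, we have
`Σ_{v ∈ V⁻} d(v) < 31·54·|V⁺|` (in particular `Σ_{v ∈ V⁻} d(v) = O(|V⁺|)`). -/
theorem neg_charge_degree_sum_bound
    (V : Type) [Fintype V] (T : PlaneTriangulation V)
    (send : V → V → ℤ)
    (hsend : ∀ u v : V, ¬ T.graph.Adj u v → send u v = 0)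
    (h54 : ∀ v : V, finalCharge T.graph send v ≤ 54)
    (h31 : ∀ v : V, 31 ≤ vdeg T.graph v →
      31 * finalCharge T.graph send v ≤ -(2 * (vdeg T.graph v : ℤ))) :
    (∑ᶠ v ∈ {v : V | finalCharge T.graph send v < 0}, (vdeg T.graph v : ℤ)) <
      31 * 54 * (({v : V | 0 < finalCharge T.graph send v}).ncard : ℤ) := by
  classical
  have hpos : 0 < ∑ v : V, finalCharge T.graph send v :=
    sum_finalCharge T.graph send ▸ T.sum_initialCharge_pos
  have hpoint : ∀ v : V,
      (if finalCharge T.graph send v < 0 then (vdeg T.graph v : ℤ) else 0) +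
        31 * finalCharge T.graph send v ≤
      31 * 54 * (if 0 < finalCharge T.graph send v then 1 else 0) := fun v => by
    have := h54 v
    have := h31 v
    split_ifs <;> lia
  have hsum := Finset.sum_le_sum fun v (_ : v ∈ Finset.univ) => hpoint v
  rw [Finset.sum_add_distrib, ← Finset.mul_sum, ← Finset.mul_sum, ← Finset.sum_filter,
    Finset.sum_boole] at hsum
  have hneg : ∑ᶠ v ∈ {v : V | finalCharge T.graph send v < 0}, (vdeg T.graph v : ℤ) =
      ∑ v with finalCharge T.graph send v < 0, (vdeg T.graph v : ℤ) := by
    rw [← finsum_mem_coe_finset]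
    simp
  have hcard : {v : V | 0 < finalCharge T.graph send v}.ncard =
      (Finset.univ.filter fun v => 0 < finalCharge T.graph send v).card := by
    rw [← Set.ncard_coe_finset]
    simp
  rw [hneg, hcard]
  lia
end
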